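/- There exists a universal constant C > 0 with the following property: for all signs σ, σ₁, σ₂, σ₃ ∈ {−1, 1}, all dyadic numbers N₁₂₃, N₁, N₂, and every m ∈ ℤ, the cardinality of the set { (n₁, n₂, n₃) ∈ (ℤ²)³ : |n₁| ∼ N₁, |n₂| ∼ N₂, |n₁+n₂+n₃| ∼ N₁₂₃ and |φ(n₁,n₂,n₃) − m| ≤ 1 } is at most C · (N₁₂₃ · N₁ · N₂)² / med(N₁₂₃, N₁, N₂)^{1/2}. -/

import Mathlib

/-- The Euclidean norm of a lattice point `x ∈ ℤ²`. -/
noncomputable def znorm (x : Fin 2 → ℤ) : ℝ :=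
  Real.sqrt ((x 0 : ℝ) ^ 2 + (x 1 : ℝ) ^ 2)

/-- The Japanese bracket `⟨x⟩ = √(1 + |x|²)` for lattice points `x ∈ ℤ²`. -/
noncomputable def jb (x : Fin 2 → ℤ) : ℝ :=
  Real.sqrt (1 + (x 0 : ℝ) ^ 2 + (x 1 : ℝ) ^ 2)

/-- `|x| ∼ N`, i.e. `N/2 ≤ |x| ≤ 2N`. -/
def ann (N : ℝ) (x : Fin 2 → ℤ) : Prop :=
  N / 2 ≤ znorm x ∧ znorm x ≤ 2 * N

/-- The cubic phase function `φ(n₁,n₂,n₃) = σ⟨n₁+n₂+n₃⟩ + σ₁⟨n₁⟩ + σ₂⟨n₂⟩ + σ₃⟨n₃⟩`. -/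
noncomputable def phase (σ σ₁ σ₂ σ₃ : ℝ) (n₁ n₂ n₃ : Fin 2 → ℤ) : ℝ :=
  σ * jb (n₁ + n₂ + n₃) + σ₁ * jb n₁ + σ₂ * jb n₂ + σ₃ * jb n₃

/-- The median (middle value) of three real numbers. -/
noncomputable def med3 (a b c : ℝ) : ℝ :=
  max (min a b) (min (max a b) c)

/-- The counting set of the cubic counting estimate (ii), where the third constraint is on the
output frequency `n₁+n₂+n₃`. -/
def cubicSet' (σ σ₁ σ₂ σ₃ N₁ N₂ N₁₂₃ : ℝ) (m : ℤ) : Set (Fin 3 → Fin 2 → ℤ) :=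
  {v | ann N₁ (v 0) ∧ ann N₂ (v 1) ∧ ann N₁₂₃ (v 0 + v 1 + v 2) ∧
    |phase σ σ₁ σ₂ σ₃ (v 0) (v 1) (v 2) - (m : ℝ)| ≤ 1}

open Finset

/-- A finite set of integers of diameter at most `L` has at most `L + 1` elements. -/
lemma card_le_of_sub_le (s : Finset ℤ) {L : ℝ} (hL : 0 ≤ L)
    (h : ∀ x ∈ s, ∀ y ∈ s, (y : ℝ) - x ≤ L) : (s.card : ℝ) ≤ L + 1 := by
  rcases s.eq_empty_or_nonempty with rfl | hs
  · simp; linarith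
  have hsub : s ⊆ Icc (s.min' hs) (s.min' hs + ⌊L⌋) := by
    intro y hy
    have h1 := h _ (s.min'_mem hs) y hy
    have h2 : y - s.min' hs ≤ ⌊L⌋ := Int.le_floor.2 (by push_cast; exact h1)
    exact mem_Icc.2 ⟨s.min'_le y hy, by linarith⟩
  have h1 := card_le_card hsub
  have h0 : 0 ≤ ⌊L⌋ := Int.floor_nonneg.2 hL
  rw [Int.card_Icc, show s.min' hs + ⌊L⌋ + 1 - s.min' hs = ⌊L⌋ + 1 by ring] at h1
  have h2 : (s.card : ℤ) ≤ ⌊L⌋ + 1 := by omega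
  have h3 : (s.card : ℝ) ≤ (⌊L⌋ : ℝ) + 1 := by exact_mod_cast h2
  linarith [Int.floor_le L]

lemma sum_Icc_natAbs_le {f : ℕ → ℝ} (hf : ∀ n, 0 ≤ f n) (K : ℕ) :
    ∑ i ∈ Icc (-(K : ℤ)) K, f i.natAbs ≤ 2 * ∑ i ∈ range (K + 1), f i := by
  rw [Finset.sum_comp, mul_sum]
  have himg : (Icc (-(K : ℤ)) K).image Int.natAbs ⊆ range (K + 1) := by
    intro n hn
    obtain ⟨i, hi, rfl⟩ := mem_image.1 hn
    rw [mem_Icc] at hi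
    rw [mem_range]
    omega
  refine (sum_le_sum fun n _ => ?_).trans
    (sum_le_sum_of_subset_of_nonneg himg fun n _ _ => mul_nonneg zero_le_two (hf n))
  have hc : #{a ∈ Icc (-(K : ℤ)) K | a.natAbs = n} ≤ 2 := by
    refine (card_le_card (t := {(n : ℤ), -(n : ℤ)}) ?_).trans card_le_two
    intro a ha
    rw [mem_filter] at ha
    simp only [mem_insert, mem_singleton]
    omega
  rw [nsmul_eq_mul]
  exact mul_le_mul_of_nonneg_right (by exact_mod_cast hc) (hf n)

lemma sum_inv_sqrt_le (K : ℕ) :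
    ∑ i ∈ range (K + 1), 1 / √(max 1 (i : ℝ)) ≤ 1 + 2 * √K := by
  induction K with
  | zero => simp
  | succ K ih =>
    rw [sum_range_succ]
    have h1 : max 1 ((K + 1 : ℕ) : ℝ) = K + 1 := by
      push_cast
      exact max_eq_right (by linarith [Nat.cast_nonneg (α := ℝ) K])
    rw [h1]
    push_cast
    have ha := Real.sq_sqrt (Nat.cast_nonneg (α := ℝ) K)
    have hb := Real.sq_sqrt (show (0 : ℝ) ≤ K + 1 by positivity)
    have hb0 : 0 < √((K : ℝ) + 1) := by positivity
    have ha0 := Real.sqrt_nonneg (K : ℝ)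
    have : 1 / √((K : ℝ) + 1) ≤ 2 * √((K : ℝ) + 1) - 2 * √(K : ℝ) := by
      rw [div_le_iff₀ hb0]
      nlinarith [sq_nonneg (√((K : ℝ) + 1) - √(K : ℝ))]
    linarith

lemma sum_inv_add_sq_le {M : ℝ} (hM : 1 / 3 ≤ M) (K : ℕ) :
    ∑ i ∈ range K, 1 / (M + i) ^ 2 ≤ 4 / M := by
  have key : ∀ K : ℕ, ∑ i ∈ range K, 1 / (M + i) ^ 2 ≤ 4 / M - 4 / (M + K) := by
    intro K
    induction K with
    | zero => simp
    | succ K ih =>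
      rw [sum_range_succ]
      have hK := Nat.cast_nonneg (α := ℝ) K
      have hx : 1 / 3 ≤ M + K := by linarith
      have : 1 / (M + K) ^ 2 ≤ 4 / (M + K) - 4 / (M + (K + 1)) := by
        rw [← add_assoc]
        generalize M + (K : ℝ) = x at hx
        have hx0 : 0 < x := by linarith
        rw [div_sub_div _ _ hx0.ne' (by positivity), div_le_div_iff₀ (by positivity) (by positivity)]
        nlinarith [mul_pos hx0 hx0]
      push_cast
      linarith
  have : 0 ≤ 4 / (M + K) := by positivity
  linarith [key K]

/-- Counting points of a planar set along the fibres of the second coordinate. -/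
lemma card_le_sum_of_fiber_snd {E : Finset (ℤ × ℤ)} {K : ℕ} {c : ℤ → ℝ}
    (hE : ∀ x ∈ E, x.2 ∈ Icc (-(K : ℤ)) K)
    (hc : ∀ j ∈ Icc (-(K : ℤ)) K, ∀ s : Finset ℤ, (∀ i ∈ s, (i, j) ∈ E) → (s.card : ℝ) ≤ c j) :
    (E.card : ℝ) ≤ ∑ j ∈ Icc (-(K : ℤ)) K, c j := by
  rw [card_eq_sum_card_fiberwise (f := Prod.snd) (t := Icc (-(K : ℤ)) K) hE]
  push_cast
  refine sum_le_sum fun j hj => ?_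
  have hcard : #(({x ∈ E | x.2 = j}).image Prod.fst) = #{x ∈ E | x.2 = j} := by
    refine card_image_of_injOn fun x hx y hy hxy => Prod.ext hxy ?_
    simp only [coe_filter, Set.mem_ofPred_eq] at hx hy
    rw [hx.2, hy.2]
  rw [← hcard]
  refine hc j hj _ fun i hi => ?_
  obtain ⟨x, hx, rfl⟩ := mem_image.1 hi
  rw [mem_filter] at hx
  rw [← hx.2]
  exact hx.1

lemma card_Icc_neg (K : ℕ) : #(Icc (-(K : ℤ)) K) = 2 * K + 1 := by
  rw [Int.card_Icc]
  omega

lemma abs_sqrt_add_sq_sub_le {c : ℝ} (hc : 0 ≤ c) (x y : ℝ) :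
    |√(c + x ^ 2) - √(c + y ^ 2)| ≤ |x - y| := by
  have key : ∀ x y : ℝ, √(c + x ^ 2) ≤ √(c + y ^ 2) + |x - y| := by
    intro x y
    have h1 := Real.sq_sqrt (show 0 ≤ c + y ^ 2 by positivity)
    have h2 : |y| ≤ √(c + y ^ 2) := Real.abs_le_sqrt (by linarith)
    refine Real.sqrt_le_iff.2 ⟨by positivity, ?_⟩
    have h3 : y * (x - y) ≤ |y| * |x - y| := (le_abs_self _).trans (abs_mul _ _).le
    nlinarith [sq_abs (x - y), mul_le_mul_of_nonneg_right h2 (abs_nonneg (x - y))]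
  rw [abs_sub_le_iff]
  constructor
  · linarith [key x y]
  · linarith [key y x, abs_sub_comm x y]

/-- Elliptic case: the sum of the two brackets varies fast transversally to the focal axis. -/
lemma card_ellipse_le {N : ℕ} (hN : 1 ≤ N) {D μ : ℝ} {E : Finset (ℤ × ℤ)}
    (hE : ∀ x ∈ E, x.1 ∈ Icc (-((5 * N : ℕ) : ℤ)) (5 * N : ℕ) ∧
      x.2 ∈ Icc (-((5 * N : ℕ) : ℤ)) (5 * N : ℕ) ∧
      |√(1 + (x.1 : ℝ) ^ 2 + (x.2 : ℝ) ^ 2) + √(1 + (x.1 + D) ^ 2 + (x.2 : ℝ) ^ 2) - μ| ≤ 5) :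
    (E.card : ℝ) ≤ 308 * N * √N := by
  have hN' : (1 : ℝ) ≤ N := by exact_mod_cast hN
  have hs1 : 1 ≤ √(N : ℝ) := Real.one_le_sqrt.2 hN'
  have hs2 := Real.sq_sqrt (show (0 : ℝ) ≤ N by positivity)
  have hle : ∀ i j k : ℤ, (i, j) ∈ E → (i, k) ∈ E → (j : ℝ) ^ 2 ≤ (k : ℝ) ^ 2 →
      (k : ℝ) ^ 2 - (j : ℝ) ^ 2 ≤ 160 * N := by
    intro i j k hj hk hjk
    obtain ⟨hi, hj2, hj3⟩ := hE _ hj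
    obtain ⟨-, hk2, hk3⟩ := hE _ hk
    simp only [mem_Icc] at hi hj2 hk2 hj3 hk3
    have bound : ∀ l : ℤ, -((5 * N : ℕ) : ℤ) ≤ l ∧ l ≤ (5 * N : ℕ) → (l : ℝ) ^ 2 ≤ 25 * N ^ 2 := by
      rintro l ⟨h1, h2⟩
      have h1' : -(5 * (N : ℝ)) ≤ l := by exact_mod_cast h1
      have h2' : (l : ℝ) ≤ 5 * N := by exact_mod_cast h2
      nlinarith
    have bi := bound i hi
    have bj := bound j hj2
    have bk := bound k hk2
    have R : ∀ l : ℝ, l ^ 2 ≤ 25 * N ^ 2 → √(1 + (i : ℝ) ^ 2 + l ^ 2) ≤ 8 * N := by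
      intro l hl
      exact Real.sqrt_le_iff.2 ⟨by positivity, by nlinarith⟩
    have rj := R j bj
    have rk := R k bk
    have sj := Real.sq_sqrt (show 0 ≤ 1 + (i : ℝ) ^ 2 + (j : ℝ) ^ 2 by positivity)
    have sk := Real.sq_sqrt (show 0 ≤ 1 + (i : ℝ) ^ 2 + (k : ℝ) ^ 2 by positivity)
    have m1 : √(1 + (i : ℝ) ^ 2 + (j : ℝ) ^ 2) ≤ √(1 + (i : ℝ) ^ 2 + (k : ℝ) ^ 2) :=
      Real.sqrt_le_sqrt (by linarith)
    have m2 : √(1 + (i + D) ^ 2 + (j : ℝ) ^ 2) ≤ √(1 + (i + D) ^ 2 + (k : ℝ) ^ 2) :=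
      Real.sqrt_le_sqrt (by linarith)
    have u : √(1 + (i : ℝ) ^ 2 + (k : ℝ) ^ 2) - √(1 + (i : ℝ) ^ 2 + (j : ℝ) ^ 2) ≤ 10 := by
      linarith [(abs_le.1 hj3).1, (abs_le.1 hk3).2]
    nlinarith [Real.sqrt_nonneg (1 + (i : ℝ) ^ 2 + (j : ℝ) ^ 2),
      Real.sqrt_nonneg (1 + (i : ℝ) ^ 2 + (k : ℝ) ^ 2)]
  have hdiam : ∀ i j k : ℤ, (i, j) ∈ E → (i, k) ∈ E → 0 ≤ (j : ℝ) * k →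
      (k : ℝ) - j ≤ 13 * √N := by
    intro i j k hj hk hjk
    refine abs_le_of_sq_le_sq' (a := (k : ℝ) - j) ?_ (by positivity) |>.2
    rcases le_total ((j : ℝ) ^ 2) ((k : ℝ) ^ 2) with h | h
    · have := hle i j k hj hk h
      have h' := sq_le_sq.1 h
      have : (j : ℝ) ^ 2 ≤ j * k := by
        rw [← abs_of_nonneg hjk, abs_mul, ← sq_abs, sq]
        exact mul_le_mul_of_nonneg_left h' (abs_nonneg _)
      nlinarith
    · have := hle i k j hk hj h
      have h' := sq_le_sq.1 h
      have : (k : ℝ) ^ 2 ≤ j * k := by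
        rw [← abs_of_nonneg hjk, abs_mul, ← sq_abs, sq]
        exact mul_le_mul_of_nonneg_right h' (abs_nonneg _)
      nlinarith
  have hswap : #(E.map (Equiv.prodComm ℤ ℤ).toEmbedding) = #E := card_map _
  rw [← hswap]
  have hmem : ∀ i j : ℤ, (i, j) ∈ E.map (Equiv.prodComm ℤ ℤ).toEmbedding → (j, i) ∈ E := by
    intro i j h
    simpa using h
  refine (card_le_sum_of_fiber_snd (K := 5 * N) (c := fun _ => 28 * √N) ?_ ?_).trans ?_
  · rintro ⟨j, i⟩ h
    exact (hE _ (hmem _ _ h)).1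
  · intro i _ s hs
    have h1 : (#{j ∈ s | 0 ≤ j} : ℝ) ≤ 13 * √N + 1 := by
      refine card_le_of_sub_le _ (by positivity) fun j hj k hk => ?_
      rw [mem_filter] at hj hk
      exact hdiam i j k (hmem _ _ (hs _ hj.1)) (hmem _ _ (hs _ hk.1))
        (by exact_mod_cast mul_nonneg hj.2 hk.2)
    have h2 : (#{j ∈ s | ¬ 0 ≤ j} : ℝ) ≤ 13 * √N + 1 := by
      refine card_le_of_sub_le _ (by positivity) fun j hj k hk => ?_
      rw [mem_filter] at hj hk
      exact hdiam i j k (hmem _ _ (hs _ hj.1)) (hmem _ _ (hs _ hk.1))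
        (by exact_mod_cast mul_nonneg_of_nonpos_of_nonpos (not_le.1 hj.2).le (not_le.1 hk.2).le)
    have h3 : (#s : ℝ) = #{j ∈ s | 0 ≤ j} + #{j ∈ s | ¬ 0 ≤ j} := by
      exact_mod_cast (card_filter_add_card_filter_not (s := s) (fun j => 0 ≤ j)).symm
    linarith
  · rw [sum_const, card_Icc_neg, nsmul_eq_mul]
    push_cast
    nlinarith

/-- A quantitative form of the strict monotonicity of `s ↦ s / √(T + s²)`. -/
lemma le_div_sqrt_sub_div_sqrt {T R x y : ℝ} (hT : 0 < T) (hxy : x ≤ y)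
    (hx : √(T + x ^ 2) ≤ R) (hy : √(T + y ^ 2) ≤ R) :
    T / R ^ 3 * (y - x) ≤ y / √(T + y ^ 2) - x / √(T + x ^ 2) := by
  have ha0 : 0 < √(T + x ^ 2) := by positivity
  have hb0 : 0 < √(T + y ^ 2) := by positivity
  have ha := Real.sq_sqrt (show 0 ≤ T + x ^ 2 by positivity)
  have hb := Real.sq_sqrt (show 0 ≤ T + y ^ 2 by positivity)
  generalize √(T + x ^ 2) = a at *
  generalize √(T + y ^ 2) = b at *
  have hR : 0 < R := ha0.trans_le hx
  rcases hxy.eq_or_lt with rfl | hlt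
  · have : a = b := by nlinarith
    simp [this]
  have hcs : T + x * y ≤ a * b := by
    refine le_of_sq_le_sq ?_ (by positivity)
    nlinarith [sq_nonneg (x - y), mul_pos hT hT]
  have hq : T * (y - x) ^ 2 ≤ 2 * (a * b) * (a * b - (T + x * y)) := by
    have h1 : (a * b + (T + x * y)) * (a * b - (T + x * y)) = T * (y - x) ^ 2 := by
      linear_combination b ^ 2 * ha + (T + x ^ 2) * hb
    nlinarith
  have hd : 0 < y - x := sub_pos.2 hlt
  refine le_of_mul_le_mul_right ?_ hd
  have hid : (y / b - x / a) * (y - x) = (a + b) * (a * b - (T + x * y)) / (a * b) := by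
    field_simp
    linear_combination (-b) * ha - a * hb
  have hab : 1 / R ^ 3 ≤ (a + b) / (2 * (a * b) ^ 2) := by
    rw [div_le_div_iff₀ (by positivity) (by positivity)]
    have e1 : a * b * b ≤ R ^ 3 := by
      calc a * b * b ≤ R * R * R := by gcongr
        _ = R ^ 3 := by ring
    have e2 : a * b * a ≤ R ^ 3 := by
      calc a * b * a ≤ R * R * R := by gcongr
        _ = R ^ 3 := by ring
    nlinarith
  calc T / R ^ 3 * (y - x) * (y - x) = T * (y - x) ^ 2 * (1 / R ^ 3) := by ring
    _ ≤ T * (y - x) ^ 2 * ((a + b) / (2 * (a * b) ^ 2)) := by gcongr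
    _ ≤ 2 * (a * b) * (a * b - (T + x * y)) * ((a + b) / (2 * (a * b) ^ 2)) := by gcongr
    _ = (y / b - x / a) * (y - x) := by
      rw [hid]
      field_simp

/-- Hyperbolic case: the difference of the two brackets varies fast along the focal axis. -/
lemma card_hyperbola_le {N : ℕ} (hN : 1 ≤ N) {D μ : ℝ} (hD : 1 ≤ D) (hDN : D ≤ 6 * N)
    {E : Finset (ℤ × ℤ)}
    (hE : ∀ x ∈ E, x.1 ∈ Icc (-((5 * N : ℕ) : ℤ)) (5 * N : ℕ) ∧
      x.2 ∈ Icc (-((5 * N : ℕ) : ℤ)) (5 * N : ℕ) ∧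
      |√(1 + (x.1 : ℝ) ^ 2 + (x.2 : ℝ) ^ 2) - √(1 + (x.1 + D) ^ 2 + (x.2 : ℝ) ^ 2) - μ| ≤ 5) :
    (E.card : ℝ) ≤ 1000000 * N ^ 2 / √D := by
  have hN' : (1 : ℝ) ≤ N := by exact_mod_cast hN
  have hs : 1 ≤ √D := Real.one_le_sqrt.2 hD
  have hs2 := Real.sq_sqrt (show 0 ≤ D by linarith)
  have hsN : √D ≤ 3 * N := Real.sqrt_le_iff.2 ⟨by positivity, by nlinarith⟩
  have bound : ∀ l : ℤ, l ∈ Icc (-((5 * N : ℕ) : ℤ)) (5 * N : ℕ) →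
      -(5 * (N : ℝ)) ≤ l ∧ (l : ℝ) ≤ 5 * N := by
    intro l hl
    rw [mem_Icc] at hl
    exact ⟨by exact_mod_cast hl.1, by exact_mod_cast hl.2⟩
  have hdiam : ∀ i k j : ℤ, (i, j) ∈ E → (k, j) ∈ E →
      (k : ℝ) - i ≤ 21970 * N ^ 3 / ((1 + (j : ℝ) ^ 2) * D) := by
    intro i k j hi hk
    rcases le_total k i with hki | hik
    · have : (k : ℝ) ≤ i := by exact_mod_cast hki
      have : 0 ≤ 21970 * N ^ 3 / ((1 + (j : ℝ) ^ 2) * D) := by positivity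
      linarith
    obtain ⟨hi1, hj, hi3⟩ := hE _ hi
    obtain ⟨hk1, -, hk3⟩ := hE _ hk
    simp only at hi1 hj hk1 hi3 hk3
    have bi := bound i hi1
    have bj := bound j hj
    have bk := bound k hk1
    set T : ℝ := 1 + (j : ℝ) ^ 2 with hT
    have hT0 : 0 < T := by positivity
    have hTN : T ≤ 26 * N ^ 2 := by nlinarith
    have e : ∀ s : ℝ, 1 + s ^ 2 + (j : ℝ) ^ 2 = T + s ^ 2 := fun s => by rw [hT]; ring
    rw [e, e] at hi3 hk3
    have hpos : ∀ s : ℝ, T + s ^ 2 ≠ 0 := fun s => by positivity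
    have hsqrt : ∀ c s : ℝ, HasDerivAt (fun s => √(T + (s + c) ^ 2))
        ((s + c) / √(T + (s + c) ^ 2)) s := by
      intro c s
      have h : HasDerivAt (fun s => T + (s + c) ^ 2) (2 * (s + c)) s := by
        simpa using (((hasDerivAt_id s).add_const c).fun_pow 2).const_add T
      have h' := h.sqrt (hpos _)
      rwa [mul_div_mul_left _ _ two_ne_zero] at h'
    have hder : ∀ s : ℝ, HasDerivAt (fun s => √(T + s ^ 2) - √(T + (s + D) ^ 2))
        (s / √(T + s ^ 2) - (s + D) / √(T + (s + D) ^ 2)) s := fun s => by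
      simpa only [add_zero] using (hsqrt 0 s).fun_sub (hsqrt D s)
    have hcont : Continuous fun s : ℝ => √(T + s ^ 2) - √(T + (s + D) ^ 2) := by fun_prop
    have hmvt := (convex_Icc (i : ℝ) k).image_sub_le_mul_sub_of_deriv_le
      (C := -(T / (13 * N) ^ 3 * D)) hcont.continuousOn
      (fun s _ => (hder s).differentiableAt.differentiableWithinAt) (fun s hs => by
        rw [(hder s).deriv]
        rw [interior_Icc] at hs
        have hs1 : -(5 * (N : ℝ)) ≤ s := bi.1.trans hs.1.le
        have hs2 : s ≤ 5 * (N : ℝ) := hs.2.le.trans bk.2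
        have := le_div_sqrt_sub_div_sqrt (R := 13 * N) hT0 (show s ≤ s + D by linarith)
          (Real.sqrt_le_iff.2 ⟨by positivity, by nlinarith⟩)
          (Real.sqrt_le_iff.2 ⟨by positivity, by nlinarith⟩)
        rw [add_sub_cancel_left] at this
        linarith) i (Set.left_mem_Icc.2 (by exact_mod_cast hik)) k
        (Set.right_mem_Icc.2 (by exact_mod_cast hik)) (by exact_mod_cast hik)
    have h10 : T / (13 * N) ^ 3 * D * (k - i) ≤ 10 := by
      linarith [(abs_le.1 hi3).2, (abs_le.1 hk3).1]
    rw [le_div_iff₀ (by positivity)]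
    rw [div_mul_eq_mul_div, div_mul_eq_mul_div, div_le_iff₀ (by positivity)] at h10
    linarith
  set M : ℝ := N / √D with hM
  have hM0 : 0 < M := by positivity
  have hM3 : 1 / 3 ≤ M := by
    rw [hM, div_le_div_iff₀ (by norm_num) (by positivity)]
    linarith
  have hM2 : M ^ 2 = N ^ 2 / D := by rw [hM, div_pow, hs2]
  refine (card_le_sum_of_fiber_snd (K := 5 * N)
    (c := fun j => 1 + 88000 * N * M ^ 2 * (1 / (M + j.natAbs) ^ 2))
    (fun x hx => (hE x hx).2.1) ?_).trans ?_
  · intro j _ s hs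
    rw [Nat.cast_natAbs, Int.cast_abs]
    have hjp := abs_nonneg (j : ℝ)
    rcases le_total |(j : ℝ)| M with hjM | hjM
    · have h1 : (#s : ℝ) ≤ 10 * N + 1 := by
        refine card_le_of_sub_le s (by positivity) fun x hx y hy => ?_
        linarith [bound x (hE _ (hs x hx)).1, (bound x (hE _ (hs x hx)).1).1,
          (bound y (hE _ (hs y hy)).1).2]
      have h2 : 1 / 4 ≤ M ^ 2 * (1 / (M + |(j : ℝ)|) ^ 2) := by
        rw [mul_one_div, div_le_div_iff₀ (by norm_num) (by positivity)]
        nlinarith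
      nlinarith
    · have h1 : (#s : ℝ) ≤ 21970 * N ^ 3 / ((1 + (j : ℝ) ^ 2) * D) + 1 :=
        card_le_of_sub_le s (by positivity) fun x hx y hy => hdiam x y j (hs x hx) (hs y hy)
      have h2 : 21970 * N ^ 3 / ((1 + (j : ℝ) ^ 2) * D) =
          21970 * N * M ^ 2 * (1 / (1 + (j : ℝ) ^ 2)) := by
        rw [hM2]
        field_simp
      have h3 : 1 / (1 + (j : ℝ) ^ 2) ≤ 4 * (1 / (M + |(j : ℝ)|) ^ 2) := by
        rw [mul_one_div, div_le_div_iff₀ (by positivity) (by positivity), ← sq_abs (j : ℝ)]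
        nlinarith
      have h4 : 21970 * N * M ^ 2 * (1 / (1 + (j : ℝ) ^ 2)) ≤
          21970 * N * M ^ 2 * (4 * (1 / (M + |(j : ℝ)|) ^ 2)) := by gcongr
      have h5 : 0 ≤ N * M ^ 2 * (1 / (M + |(j : ℝ)|) ^ 2) := by positivity
      linarith
  · rw [sum_add_distrib, ← mul_sum, sum_const, card_Icc_neg, nsmul_eq_mul]
    have h1 := (sum_Icc_natAbs_le (f := fun i : ℕ => 1 / (M + i) ^ 2)
      (fun i => by positivity) (5 * N)).trans
      (mul_le_mul_of_nonneg_left (sum_inv_add_sq_le hM3 _) zero_le_two)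
    have h2 : 88000 * N * M ^ 2 * ∑ i ∈ Icc (-((5 * N : ℕ) : ℤ)) (5 * N : ℕ),
        1 / (M + i.natAbs) ^ 2 ≤ 88000 * N * M ^ 2 * (2 * (4 / M)) := by gcongr
    have h3 : 88000 * N * M ^ 2 * (2 * (4 / M)) = 704000 * (N ^ 2 / √D) := by
      rw [hM]
      field_simp
      norm_num
    have h4 : (N : ℝ) ≤ 3 * (N ^ 2 / √D) := by
      rw [mul_div_assoc', le_div_iff₀ (by positivity)]
      nlinarith
    push_cast
    push_cast at h2
    rw [mul_div_assoc]
    linarith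

/-- Rounding a rotation of `ℤ²` to the lattice is at most nine-to-one. -/
lemma card_le_nine_mul_card_image_rotation {p q : ℝ} (hpq : p ^ 2 + q ^ 2 = 1)
    (F : Finset (Fin 2 → ℤ)) :
    #F ≤ 9 * #(F.image fun a => (⌊p * a 0 + q * a 1⌋, ⌊p * a 1 - q * a 0⌋)) := by
  refine card_le_mul_card_image F 9 fun w hw => ?_
  obtain ⟨b, hb, rfl⟩ := mem_image.1 hw
  have hbox : #(Fintype.piFinset fun _ : Fin 2 => Icc (-1 : ℤ) 1) = 9 := by
    simp [Fintype.card_piFinset]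
  rw [← hbox]
  refine card_le_card_of_injOn (fun a => a - b) (fun a ha => ?_)
    (fun x _ y _ h => sub_left_injective h)
  simp only [coe_filter, Set.mem_ofPred_eq, Prod.mk.injEq] at ha
  obtain ⟨-, h1, h2⟩ := ha
  have e1 := Int.abs_sub_lt_one_of_floor_eq_floor h1
  have e2 := Int.abs_sub_lt_one_of_floor_eq_floor h2
  rw [← sq_lt_one_iff_abs_lt_one] at e1 e2
  have hsum : ((a 0 : ℝ) - b 0) ^ 2 + ((a 1 : ℝ) - b 1) ^ 2 < 2 := by
    have : ((a 0 : ℝ) - b 0) ^ 2 + ((a 1 : ℝ) - b 1) ^ 2 =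
        (p * a 0 + q * a 1 - (p * b 0 + q * b 1)) ^ 2 +
          (p * a 1 - q * a 0 - (p * b 1 - q * b 0)) ^ 2 := by
      linear_combination (-((a 0 : ℝ) - b 0) ^ 2 - ((a 1 : ℝ) - b 1) ^ 2) * hpq
    linarith
  have hsum' : (a 0 - b 0) ^ 2 + (a 1 - b 1) ^ 2 < 2 := by exact_mod_cast hsum
  have hsmall : ∀ x y : ℤ, x ^ 2 + y ^ 2 < 2 → -1 ≤ x ∧ x ≤ 1 := fun x y h =>
    ⟨by nlinarith [sq_nonneg y], by nlinarith [sq_nonneg y]⟩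
  simp only [mem_coe, Fintype.mem_piFinset, mem_Icc, Pi.sub_apply, Fin.forall_fin_two]
  exact ⟨hsmall _ _ hsum', hsmall _ (a 0 - b 0) (by linarith)⟩

lemma exists_polar (x y : ℝ) : ∃ D p q : ℝ, 0 ≤ D ∧ p ^ 2 + q ^ 2 = 1 ∧ x = D * p ∧ y = D * q := by
  have hD := Real.sq_sqrt (show 0 ≤ x ^ 2 + y ^ 2 by positivity)
  rcases (Real.sqrt_nonneg (x ^ 2 + y ^ 2)).eq_or_lt with h | h
  · rw [← h] at hD
    exact ⟨0, 1, 0, le_rfl, by norm_num, by nlinarith, by nlinarith⟩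
  · refine ⟨√(x ^ 2 + y ^ 2), x / √(x ^ 2 + y ^ 2), y / √(x ^ 2 + y ^ 2), h.le, ?_, ?_, ?_⟩
    · rw [div_pow, div_pow, hD, ← add_div, div_self]
      rw [← hD]
      positivity
    · field_simp
    · field_simp

lemma abs_sqrt_floor_sub_le (x y c : ℝ) :
    |√(1 + (⌊x⌋ + c) ^ 2 + (⌊y⌋ : ℝ) ^ 2) - √(1 + (x + c) ^ 2 + y ^ 2)| ≤ 2 := by
  have h1 := abs_sqrt_add_sq_sub_le (show 0 ≤ 1 + (⌊x⌋ + c) ^ 2 by positivity) ⌊y⌋ y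
  have h2 := abs_sqrt_add_sq_sub_le (show 0 ≤ 1 + y ^ 2 by positivity) (⌊x⌋ + c) (x + c)
  have fl : ∀ z : ℝ, |(⌊z⌋ : ℝ) - z| ≤ 1 := fun z =>
    abs_le.2 ⟨by linarith [Int.sub_one_lt_floor z], by linarith [Int.floor_le z]⟩
  have h3 := fl y
  have h4 := fl x
  rw [add_sub_add_right_eq_sub, add_right_comm 1 (y ^ 2), add_right_comm 1 (y ^ 2)] at h2
  have := abs_sub_le √(1 + (⌊x⌋ + c) ^ 2 + (⌊y⌋ : ℝ) ^ 2) √(1 + (⌊x⌋ + c) ^ 2 + y ^ 2)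
    √(1 + (x + c) ^ 2 + y ^ 2)
  linarith

/-- The basic counting estimate for two brackets whose arguments differ by a fixed vector `d`. -/
lemma card_two_brackets_le {N : ℕ} (hN : 1 ≤ N) {s s' μ : ℝ} (hs : s = -1 ∨ s = 1)
    (hs' : s' = -1 ∨ s' = 1) {d : Fin 2 → ℤ} (hd : ∀ i, |(d i : ℝ)| ≤ 4 * N)
    {F : Finset (Fin 2 → ℤ)}
    (hF : ∀ a ∈ F, (∀ i, |(a i : ℝ)| ≤ 2 * N) ∧ |s * jb a + s' * jb (a + d) - μ| ≤ 1) :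
    (F.card : ℝ) ≤ 9000000 * N ^ 2 / √(max 1 |(d 0 : ℝ)|) := by
  have hN' : (1 : ℝ) ≤ N := by exact_mod_cast hN
  obtain ⟨D, p, q, hD, hpq, h0, h1⟩ := exists_polar (d 0) (d 1)
  have hp : |p| ≤ 1 := abs_le_one_iff_mul_self_le_one.2 (by nlinarith)
  have hq : |q| ≤ 1 := abs_le_one_iff_mul_self_le_one.2 (by nlinarith)
  have hd0 : |(d 0 : ℝ)| ≤ D := by
    rw [h0, abs_mul, abs_of_nonneg hD]
    exact mul_le_of_le_one_right hD hp
  have hDN : D ≤ 6 * N := by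
    have e0 := sq_le_sq' (abs_le.1 (hd 0)).1 (abs_le.1 (hd 0)).2
    have e1 := sq_le_sq' (abs_le.1 (hd 1)).1 (abs_le.1 (hd 1)).2
    refine le_of_sq_le_sq ?_ (by positivity)
    rw [h0] at e0
    rw [h1] at e1
    nlinarith
  set E := F.image fun a => (⌊p * a 0 + q * a 1⌋, ⌊p * a 1 - q * a 0⌋)
  have hcard : (#F : ℝ) ≤ 9 * #E := by
    exact_mod_cast card_le_nine_mul_card_image_rotation hpq F
  have hbox : ∀ x ∈ E, x.1 ∈ Icc (-((5 * N : ℕ) : ℤ)) (5 * N : ℕ) ∧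
      x.2 ∈ Icc (-((5 * N : ℕ) : ℤ)) (5 * N : ℕ) := by
    intro x hx
    obtain ⟨a, ha, rfl⟩ := mem_image.1 hx
    have ha' := (hF a ha).1
    have hle : ∀ r t : ℝ, |r| ≤ 1 → |t| ≤ 2 * N → |r * t| ≤ 2 * N := fun r t hr ht => by
      rw [abs_mul]
      nlinarith [abs_nonneg r, abs_nonneg t]
    have b1 := abs_le.1 (hle p _ hp (ha' 0))
    have b2 := abs_le.1 (hle q _ hq (ha' 1))
    have b3 := abs_le.1 (hle p _ hp (ha' 1))
    have b4 := abs_le.1 (hle q _ hq (ha' 0))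
    simp only [mem_Icc, Int.le_floor]
    refine ⟨⟨?_, ?_⟩, ?_, ?_⟩
    · push_cast; linarith
    · exact_mod_cast (Int.floor_le _).trans (show p * a 0 + q * a 1 ≤ 5 * N by linarith)
    · push_cast; linarith
    · exact_mod_cast (Int.floor_le _).trans (show p * a 1 - q * a 0 ≤ 5 * N by linarith)
  have hphase : ∀ x ∈ E, |√(1 + (x.1 : ℝ) ^ 2 + (x.2 : ℝ) ^ 2) +
      s * s' * √(1 + (x.1 + D) ^ 2 + (x.2 : ℝ) ^ 2) - s * μ| ≤ 5 := by
    intro x hx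
    obtain ⟨a, ha, rfl⟩ := mem_image.1 hx
    have hja : jb a = √(1 + (p * a 0 + q * a 1 + 0) ^ 2 + (p * a 1 - q * a 0) ^ 2) := by
      rw [jb]
      congr 1
      linear_combination (-(a 0 : ℝ) ^ 2 - (a 1 : ℝ) ^ 2) * hpq
    have hjad : jb (a + d) = √(1 + (p * a 0 + q * a 1 + D) ^ 2 + (p * a 1 - q * a 0) ^ 2) := by
      rw [jb]
      congr 1
      simp only [Pi.add_apply, Int.cast_add, h0, h1]
      linear_combination (-(a 0 : ℝ) ^ 2 - (a 1 : ℝ) ^ 2 + D ^ 2) * hpq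
    have r1 := abs_sqrt_floor_sub_le (p * a 0 + q * a 1) (p * a 1 - q * a 0) 0
    have r2 := abs_sqrt_floor_sub_le (p * a 0 + q * a 1) (p * a 1 - q * a 0) D
    have r3 := (hF a ha).2
    rw [← hja, add_zero] at r1
    rw [← hjad] at r2
    simp only
    rw [abs_le] at r1 r2 r3 ⊢
    rcases hs with rfl | rfl <;> rcases hs' with rfl | rfl <;> constructor <;> linarith
  have hmain : (#E : ℝ) ≤ 1000000 * N ^ 2 / √(max 1 |(d 0 : ℝ)|) := by
    rcases lt_or_ge D 1 with hD1 | hD1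
    · rw [max_eq_left (hd0.trans hD1.le), Real.sqrt_one, div_one]
      have hsub : E ⊆ Icc (-((5 * N : ℕ) : ℤ)) (5 * N : ℕ) ×ˢ Icc (-((5 * N : ℕ) : ℤ)) (5 * N : ℕ) :=
        fun x hx => mem_product.2 (hbox x hx)
      have := card_le_card hsub
      rw [card_product, card_Icc_neg] at this
      have : (#E : ℝ) ≤ (2 * (5 * N) + 1) * (2 * (5 * N) + 1) := by exact_mod_cast this
      nlinarith
    · have hle : 1000000 * N ^ 2 / √D ≤ 1000000 * N ^ 2 / √(max 1 |(d 0 : ℝ)|) := by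
        gcongr
        exact max_le hD1 hd0
      refine le_trans ?_ hle
      have hcases : s * s' = 1 ∨ s * s' = -1 := by
        rcases hs with rfl | rfl <;> rcases hs' with rfl | rfl <;> norm_num
      rcases hcases with h | h
      · refine (card_ellipse_le hN (D := D) (μ := s * μ) fun x hx => ?_).trans ?_
        · have := hphase x hx
          rw [h, one_mul] at this
          exact ⟨(hbox x hx).1, (hbox x hx).2, this⟩
        · have hsD : √D ≤ 3 * √N := by
            refine Real.sqrt_le_iff.2 ⟨by positivity, ?_⟩
            rw [mul_pow, Real.sq_sqrt (by positivity)]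
            linarith
          rw [le_div_iff₀ (by positivity)]
          calc 308 * N * √N * √D ≤ 308 * N * √N * (3 * √N) := by gcongr
            _ = 924 * N * √N ^ 2 := by ring
            _ = 924 * N ^ 2 := by rw [Real.sq_sqrt (by positivity)]; ring
            _ ≤ 1000000 * N ^ 2 := by gcongr; norm_num
      · refine card_hyperbola_le hN hD1 hDN (μ := s * μ) fun x hx => ?_
        have := hphase x hx
        rw [h, neg_one_mul, ← sub_eq_add_neg] at this
        exact ⟨(hbox x hx).1, (hbox x hx).2, this⟩
  calc (#F : ℝ) ≤ 9 * #E := hcard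
    _ ≤ 9 * (1000000 * N ^ 2 / √(max 1 |(d 0 : ℝ)|)) := by gcongr
    _ = _ := by ring

lemma abs_apply_le_znorm (x : Fin 2 → ℤ) (i : Fin 2) : |(x i : ℝ)| ≤ znorm x := by
  refine Real.abs_le_sqrt ?_
  fin_cases i
  · simpa using sq_nonneg (x 1 : ℝ)
  · simpa using sq_nonneg (x 0 : ℝ)

lemma znorm_neg (x : Fin 2 → ℤ) : znorm (-x) = znorm x := by simp [znorm]

lemma jb_neg (x : Fin 2 → ℤ) : jb (-x) = jb x := by simp [jb]

/-- The lattice points of sup norm at most `n`. -/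
noncomputable def latticeBox (n : ℕ) : Finset (Fin 2 → ℤ) :=
  Fintype.piFinset fun _ => Icc (-(n : ℤ)) n

lemma mem_latticeBox {n : ℕ} {x : Fin 2 → ℤ} :
    x ∈ latticeBox n ↔ ∀ i, |(x i : ℝ)| ≤ n := by
  simp only [latticeBox, Fintype.mem_piFinset, mem_Icc, abs_le]
  exact forall_congr' fun i => by norm_cast

lemma card_latticeBox (n : ℕ) : #(latticeBox n) = (2 * n + 1) ^ 2 := by
  rw [latticeBox, Fintype.card_piFinset_const, card_Icc_neg]

lemma sum_latticeBox_inv_sqrt_le {B : ℕ} (hB : 1 ≤ B) {c : Fin 2 → ℤ}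
    (hc : c ∈ latticeBox (2 * B)) :
    ∑ b ∈ latticeBox (2 * B), 1 / √(max 1 |((b + c) 0 : ℝ)|) ≤ 90 * B * √B := by
  have hB' : (1 : ℝ) ≤ B := by exact_mod_cast hB
  have hs1 : 1 ≤ √(B : ℝ) := Real.one_le_sqrt.2 hB'
  have hshift : ∑ b ∈ latticeBox (2 * B), 1 / √(max 1 |((b + c) 0 : ℝ)|) ≤
      ∑ x ∈ latticeBox (4 * B), 1 / √(max 1 |(x 0 : ℝ)|) := by
    rw [← sum_image (s := latticeBox (2 * B)) (g := fun b => b + c)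
      (f := fun x => 1 / √(max 1 |(x 0 : ℝ)|)) (fun x _ y _ h => add_left_injective c h)]
    refine sum_le_sum_of_subset_of_nonneg ?_ fun _ _ _ => by positivity
    intro x hx
    obtain ⟨b, hb, rfl⟩ := mem_image.1 hx
    rw [mem_latticeBox] at hb hc ⊢
    intro i
    have h1 := abs_add_le (b i : ℝ) (c i)
    have h2 := hb i
    have h3 := hc i
    push_cast [Pi.add_apply] at h2 h3 ⊢
    linarith
  have hsum : ∑ x ∈ latticeBox (4 * B), 1 / √(max 1 |(x 0 : ℝ)|) =
      (2 * (4 * B) + 1) * ∑ i ∈ Icc (-((4 * B : ℕ) : ℤ)) (4 * B : ℕ), 1 / √(max 1 |(i : ℝ)|) := by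
    rw [latticeBox, Fintype.sum_piFinset_apply (fun i : ℤ => 1 / √(max 1 |(i : ℝ)|)),
      card_Icc_neg, nsmul_eq_mul]
    simp
  have hline := (sum_Icc_natAbs_le (f := fun i : ℕ => 1 / √(max 1 (i : ℝ)))
    (fun i => by positivity) (4 * B)).trans
    (mul_le_mul_of_nonneg_left (sum_inv_sqrt_le _) zero_le_two)
  have h4 : √((4 * B : ℕ) : ℝ) = 2 * √(B : ℝ) := by
    push_cast
    rw [Real.sqrt_mul (by norm_num), show (4 : ℝ) = 2 ^ 2 by norm_num, Real.sqrt_sq (by norm_num)]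
  simp only [Nat.cast_natAbs, Int.cast_abs] at hline
  rw [h4] at hline
  rw [hsum] at hshift
  refine hshift.trans ?_
  calc (2 * (4 * B) + 1) * ∑ i ∈ Icc (-((4 * B : ℕ) : ℤ)) (4 * B : ℕ), 1 / √(max 1 |(i : ℝ)|)
      ≤ (9 * B) * (10 * √B) := by gcongr <;> linarith
    _ = 90 * B * √B := by ring

/-- The counting estimate for three frequencies `a, b, c` in decreasing order of size, the fourth
one being `a + b + c`. -/
lemma ncard_le_of_sorted {ι : Type*} {S : Set ι} {a b c : ι → Fin 2 → ℤ}
    (hinj : Set.InjOn (fun x => (a x, b x, c x)) S) {A B C : ℕ} (hC : 1 ≤ C) (hCB : C ≤ B)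
    (hBA : B ≤ A) {s s' t t' m : ℝ} (hs : s = -1 ∨ s = 1) (hs' : s' = -1 ∨ s' = 1)
    (hS : ∀ x ∈ S, znorm (a x) ≤ 2 * A ∧ znorm (b x) ≤ 2 * B ∧ znorm (c x) ≤ 2 * C ∧
      |s * jb (a x) + s' * jb (a x + (b x + c x)) + t * jb (b x) + t' * jb (c x) - m| ≤ 1) :
    S.Finite ∧ (S.ncard : ℝ) ≤ 30000000000 * (A * B * C) ^ 2 / √B := by
  have hbox : ∀ {n : ℕ} {x : Fin 2 → ℤ}, znorm x ≤ 2 * n → x ∈ latticeBox (2 * n) := by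
    intro n x hx
    rw [mem_latticeBox]
    push_cast
    exact fun i => (abs_apply_le_znorm x i).trans hx
  have hfin : S.Finite := by
    refine Set.Finite.of_finite_image ((latticeBox (2 * A) ×ˢ latticeBox (2 * B) ×ˢ
      latticeBox (2 * C)).finite_toSet.subset ?_) hinj
    rintro _ ⟨x, hx, rfl⟩
    obtain ⟨h1, h2, h3, -⟩ := hS x hx
    simp only [mem_coe, mem_product]
    exact ⟨hbox h1, hbox h2, hbox h3⟩
  refine ⟨hfin, ?_⟩
  have hB : 1 ≤ B := hC.trans hCB
  have hA : 1 ≤ A := hB.trans hBA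
  have hB' : (1 : ℝ) ≤ B := by exact_mod_cast hB
  have hC' : (1 : ℝ) ≤ C := by exact_mod_cast hC
  have hBA' : (B : ℝ) ≤ A := by exact_mod_cast hBA
  have hCB' : (C : ℝ) ≤ B := by exact_mod_cast hCB
  have hfiber : ∀ y ∈ latticeBox (2 * B), ∀ z ∈ latticeBox (2 * C),
      (#{x ∈ hfin.toFinset | (c x, b x) = (z, y)} : ℝ) ≤
        9000000 * A ^ 2 * (1 / √(max 1 |((y + z) 0 : ℝ)|)) := by
    intro y hy z hz
    have hcard : #({x ∈ hfin.toFinset | (c x, b x) = (z, y)}.image a) =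
        #{x ∈ hfin.toFinset | (c x, b x) = (z, y)} := by
      refine card_image_of_injOn fun x hx x' hx' h => ?_
      simp only [coe_filter, Set.Finite.mem_toFinset, Set.mem_ofPred_eq, Prod.mk.injEq] at hx hx'
      refine hinj hx.1 hx'.1 ?_
      simp only [Prod.mk.injEq]
      exact ⟨h, hx.2.2.trans hx'.2.2.symm, hx.2.1.trans hx'.2.1.symm⟩
    rw [← hcard, mul_one_div]
    refine card_two_brackets_le hA hs hs' (μ := m - t * jb y - t' * jb z) ?_ ?_
    · rw [mem_latticeBox] at hy hz
      intro i
      have h1 := abs_add_le (y i : ℝ) (z i)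
      have h2 := hy i
      have h3 := hz i
      push_cast [Pi.add_apply] at h2 h3 ⊢
      linarith
    · intro v hv
      obtain ⟨x, hx, rfl⟩ := mem_image.1 hv
      simp only [mem_filter, Set.Finite.mem_toFinset, Prod.mk.injEq] at hx
      obtain ⟨hxS, rfl, rfl⟩ := hx
      obtain ⟨h1, -, -, h4⟩ := hS x hxS
      refine ⟨fun i => (abs_apply_le_znorm _ i).trans h1, ?_⟩
      convert h4 using 2
      ring
  have hmaps : Set.MapsTo (fun x => (c x, b x)) hfin.toFinset
      (latticeBox (2 * C) ×ˢ latticeBox (2 * B) : Finset _) := by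
    intro x hx
    obtain ⟨-, h2, h3, -⟩ := hS x (hfin.mem_toFinset.1 hx)
    exact mem_product.2 ⟨hbox h3, hbox h2⟩
  rw [Set.ncard_eq_toFinset_card S hfin, card_eq_sum_card_fiberwise hmaps, sum_product]
  push_cast
  have hsub : latticeBox (2 * C) ⊆ latticeBox (2 * B) := by
    intro x hx
    rw [mem_latticeBox] at hx ⊢
    exact fun i => (hx i).trans (by exact_mod_cast Nat.mul_le_mul_left 2 hCB)
  calc ∑ z ∈ latticeBox (2 * C), ∑ y ∈ latticeBox (2 * B),
        (#{x ∈ hfin.toFinset | (c x, b x) = (z, y)} : ℝ)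
      ≤ ∑ z ∈ latticeBox (2 * C), ∑ y ∈ latticeBox (2 * B),
        9000000 * A ^ 2 * (1 / √(max 1 |((y + z) 0 : ℝ)|)) :=
        sum_le_sum fun z hz => sum_le_sum fun y hy => hfiber y hy z hz
    _ ≤ ∑ z ∈ latticeBox (2 * C), 9000000 * A ^ 2 * (90 * B * √B) := by
        refine sum_le_sum fun z hz => ?_
        rw [← mul_sum]
        gcongr
        exact sum_latticeBox_inv_sqrt_le hB (hsub hz)
    _ = (4 * C + 1) ^ 2 * (9000000 * A ^ 2 * (90 * B * √B)) := by
        rw [sum_const, card_latticeBox, nsmul_eq_mul]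
        push_cast
        ring
    _ ≤ (5 * C) ^ 2 * (9000000 * A ^ 2 * (90 * B * √B)) := by
        gcongr
        linarith
    _ = 20250000000 * (A * B * C) ^ 2 / √B := by
        rw [eq_div_iff (by positivity)]
        linear_combination 20250000000 * (C : ℝ) ^ 2 * A ^ 2 * B *
          Real.sq_sqrt (show (0 : ℝ) ≤ B by positivity)
    _ ≤ 30000000000 * (A * B * C) ^ 2 / √B := by
        gcongr
        norm_num


/-- cubic counting estimate (ii): there is a universal `C > 0` such that for all
signs, dyadic `N₁₂₃, N₁, N₂` and every `m ∈ ℤ`,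
`#{(n₁,n₂,n₃) : |n₁| ∼ N₁, |n₂| ∼ N₂, |n₁+n₂+n₃| ∼ N₁₂₃, |φ − m| ≤ 1}
  ≤ C (N₁₂₃N₁N₂)² / med(N₁₂₃,N₁,N₂)^{1/2}`. -/
theorem cubic_counting_ii :
    ∃ C : ℝ, 0 < C ∧
      ∀ (σ σ₁ σ₂ σ₃ : ℝ), (σ = -1 ∨ σ = 1) → (σ₁ = -1 ∨ σ₁ = 1) →
        (σ₂ = -1 ∨ σ₂ = 1) → (σ₃ = -1 ∨ σ₃ = 1) →
        ∀ (k₁₂₃ k₁ k₂ : ℕ) (m : ℤ),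
          (cubicSet' σ σ₁ σ₂ σ₃ ((2:ℝ)^k₁) ((2:ℝ)^k₂) ((2:ℝ)^k₁₂₃) m).Finite ∧
          ((cubicSet' σ σ₁ σ₂ σ₃ ((2:ℝ)^k₁) ((2:ℝ)^k₂) ((2:ℝ)^k₁₂₃) m).ncard : ℝ) ≤
            C * ((2:ℝ)^k₁₂₃ * (2:ℝ)^k₁ * (2:ℝ)^k₂) ^ 2 /
              Real.sqrt (med3 ((2:ℝ)^k₁₂₃) ((2:ℝ)^k₁) ((2:ℝ)^k₂)) := by
  refine ⟨30000000000, by norm_num, ?_⟩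
  intro σ σ₁ σ₂ σ₃ h h₁ h₂ h₃ k₁₂₃ k₁ k₂ m
  set S := cubicSet' σ σ₁ σ₂ σ₃ ((2:ℝ)^k₁) ((2:ℝ)^k₂) ((2:ℝ)^k₁₂₃) m
  have hcast : ∀ k : ℕ, (2 : ℝ) ^ k = ((2 ^ k : ℕ) : ℝ) := fun k => by push_cast; rfl
  have hone : ∀ k : ℕ, 1 ≤ 2 ^ k := fun k => Nat.one_le_two_pow
  have hmem : ∀ v ∈ S, znorm (v 0 + v 1 + v 2) ≤ 2 * ((2 ^ k₁₂₃ : ℕ) : ℝ) ∧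
      znorm (-v 0) ≤ 2 * ((2 ^ k₁ : ℕ) : ℝ) ∧ znorm (-v 1) ≤ 2 * ((2 ^ k₂ : ℕ) : ℝ) ∧
      |σ * jb (v 0 + v 1 + v 2) + σ₁ * jb (-v 0) + σ₂ * jb (-v 1) + σ₃ * jb (v 2) - m| ≤ 1 := by
    intro v hv
    obtain ⟨h1, h2, h3, h4⟩ := hv
    rw [znorm_neg, znorm_neg, jb_neg, jb_neg, ← hcast, ← hcast, ← hcast]
    exact ⟨h3.2, h1.2, h2.2, h4⟩
  have hext : ∀ v w : Fin 3 → Fin 2 → ℤ, v 0 + v 1 + v 2 = w 0 + w 1 + w 2 → -v 0 = -w 0 →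
      -v 1 = -w 1 → v = w := by
    intro v w e e0 e1
    have e0 := neg_injective e0
    have e1 := neg_injective e1
    rw [e0, e1] at e
    have e2 := add_left_cancel e
    funext i
    fin_cases i <;> assumption
  have key : ∀ (a b c : (Fin 3 → Fin 2 → ℤ) → Fin 2 → ℤ) (A B C : ℕ) (s t t' P M : ℝ),
      (s = -1 ∨ s = 1) → 1 ≤ C → C ≤ B → B ≤ A → A * B * C = P → M = B →
      (∀ v w, a v = a w → b v = b w → c v = c w → v = w) →
      (∀ v ∈ S, a v + (b v + c v) = v 2 ∧ znorm (a v) ≤ 2 * A ∧ znorm (b v) ≤ 2 * B ∧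
        znorm (c v) ≤ 2 * C ∧
        |s * jb (a v) + t * jb (b v) + t' * jb (c v) + σ₃ * jb (v 2) - m| ≤ 1) →
      S.Finite ∧ (S.ncard : ℝ) ≤ 30000000000 * P ^ 2 / √M := by
    rintro a b c A B C s t t' P M hs hC hCB hBA rfl rfl hinj hS
    refine ncard_le_of_sorted (a := a) (b := b) (c := c) (s' := σ₃) (t := t) (t' := t') (m := m)
      (fun v _ w _ e => ?_) hC hCB hBA hs h₃ fun v hv => ?_
    · simp only [Prod.mk.injEq] at e
      exact hinj v w e.1 e.2.1 e.2.2
    · obtain ⟨e, ha, hb, hc, hp⟩ := hS v hv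
      refine ⟨ha, hb, hc, ?_⟩
      rw [e]
      convert hp using 2
      ring
  rw [hcast k₁₂₃, hcast k₁, hcast k₂]
  have hA := hone k₁₂₃
  have hB := hone k₁
  have hC := hone k₂
  generalize 2 ^ k₁₂₃ = A at hmem hA ⊢
  generalize 2 ^ k₁ = B at hmem hB ⊢
  generalize 2 ^ k₂ = C at hmem hC ⊢
  rcases le_total B A with hBA | hAB
  · rcases le_total C B with hCB | hBC
    · refine key (fun v => v 0 + v 1 + v 2) (fun v => -v 0) (fun v => -v 1) A B C σ σ₁ σ₂ _ _
        h hC hCB hBA (by ring) ?_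
        (fun v w ha hb hc => hext v w ha hb hc) fun v hv => ?_
      · have hc := hCB.trans hBA
        simp only [med3, ← Nat.cast_max, ← Nat.cast_min]
        congr 1
        omega
      · obtain ⟨hA', hB', hC', hp⟩ := hmem v hv
        exact ⟨by abel, hA', hB', hC', hp⟩
    · rcases le_total C A with hCA | hAC
      · refine key (fun v => v 0 + v 1 + v 2) (fun v => -v 1) (fun v => -v 0) A C B σ σ₂ σ₁ _ _
          h hB hBC hCA (by ring) ?_
          (fun v w ha hb hc => hext v w ha hc hb) fun v hv => ?_
        · have hc := hBC.trans hCA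
          simp only [med3, ← Nat.cast_max, ← Nat.cast_min]
          congr 1
          omega
        · obtain ⟨hA', hB', hC', hp⟩ := hmem v hv
          exact ⟨by abel, hA', hC', hB', by convert hp using 2; ring⟩
      · refine key (fun v => -v 1) (fun v => v 0 + v 1 + v 2) (fun v => -v 0) C A B σ₂ σ σ₁ _ _
          h₂ hB hBA hAC (by ring) ?_
          (fun v w ha hb hc => hext v w hb hc ha) fun v hv => ?_
        · have hc := hBA.trans hAC
          simp only [med3, ← Nat.cast_max, ← Nat.cast_min]
          congr 1
          omega
        · obtain ⟨hA', hB', hC', hp⟩ := hmem v hv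
          exact ⟨by abel, hC', hA', hB', by convert hp using 2; ring⟩
  · rcases le_total C A with hCA | hAC
    · refine key (fun v => -v 0) (fun v => v 0 + v 1 + v 2) (fun v => -v 1) B A C σ₁ σ σ₂ _ _
        h₁ hC hCA hAB (by ring) ?_
        (fun v w ha hb hc => hext v w hb ha hc) fun v hv => ?_
      · have hc := hCA.trans hAB
        simp only [med3, ← Nat.cast_max, ← Nat.cast_min]
        congr 1
        omega
      · obtain ⟨hA', hB', hC', hp⟩ := hmem v hv
        exact ⟨by abel, hB', hA', hC', by convert hp using 2; ring⟩
    · rcases le_total C B with hCB | hBC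
      · refine key (fun v => -v 0) (fun v => -v 1) (fun v => v 0 + v 1 + v 2) B C A σ₁ σ₂ σ _ _
          h₁ hA hAC hCB (by ring) ?_
          (fun v w ha hb hc => hext v w hc ha hb) fun v hv => ?_
        · have hc := hAC.trans hCB
          simp only [med3, ← Nat.cast_max, ← Nat.cast_min]
          congr 1
          omega
        · obtain ⟨hA', hB', hC', hp⟩ := hmem v hv
          exact ⟨by abel, hB', hC', hA', by convert hp using 2; ring⟩
      · refine key (fun v => -v 1) (fun v => -v 0) (fun v => v 0 + v 1 + v 2) C B A σ₂ σ₁ σ _ _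
          h₂ hA hAB hBC (by ring) ?_
          (fun v w ha hb hc => hext v w hc hb ha) fun v hv => ?_
        · have hc := hAB.trans hBC
          simp only [med3, ← Nat.cast_max, ← Nat.cast_min]
          congr 1
          omega
        · obtain ⟨hA', hB', hC', hp⟩ := hmem v hv
          exact ⟨by abel, hC', hB', hA', by convert hp using 2; ring⟩
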